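/- For every n ≥ 0, Rₙ = (α + β + 2n + 1)/2; that is, (β/hₙ) ∫_{−1}^1 Pₙ(y)² (1−y)^α (1+y)^{β−1} dy = (α + β + 2n + 1)/2. -/

import Mathlib

open MeasureTheory Polynomial

lemma jac_w_cont (α β : ℝ) (hα : 0 < α) (hβ : 0 < β) :
    Continuous (fun x : ℝ => (1 - x) ^ α * (1 + x) ^ β) :=
  ((continuous_const.sub continuous_id).rpow_const (fun _ => Or.inr hα.le)).mul
    ((continuous_const.add continuous_id).rpow_const (fun _ => Or.inr hβ.le))

lemma jac_int (α β : ℝ) (hα : 0 < α) (hβ : 0 < β) (q : Polynomial ℝ) :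
    IntervalIntegrable (fun x : ℝ => q.eval x * ((1 - x) ^ α * (1 + x) ^ β)) volume (-1) 1 :=
  (q.continuous.mul (jac_w_cont α β hα hβ)).intervalIntegrable _ _

lemma jac_int' (α β : ℝ) (hα : 0 < α) (hβ : 0 < β) (q : Polynomial ℝ) :
    IntervalIntegrable (fun x : ℝ => q.eval x * ((1 - x) ^ α * (1 + x) ^ (β - 1)))
      volume (-1) 1 := by
  have h1 : IntervalIntegrable (fun x : ℝ => x ^ (β - 1)) volume 0 2 :=
    intervalIntegral.intervalIntegrable_rpow' (by linarith)
  have h2 := h1.comp_add_left 1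
  have h3 : IntervalIntegrable (fun x : ℝ => (1 + x) ^ (β - 1)) volume (-1) 1 := by
    convert h2 using 1 <;> norm_num
  have hc : Continuous (fun x : ℝ => q.eval x * (1 - x) ^ α) :=
    q.continuous.mul ((continuous_const.sub continuous_id).rpow_const (fun _ => Or.inr hα.le))
  have h4 := h3.continuousOn_mul hc.continuousOn
  refine h4.congr ?_
  intro x _
  simp only [mul_assoc]

lemma jac_orth (α β : ℝ) (hα : 0 < α) (hβ : 0 < β)
    (P : ℕ → Polynomial ℝ)
    (hmonic : ∀ n, (P n).Monic) (hdeg : ∀ n, (P n).natDegree = n)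
    (horth : ∀ m n : ℕ, m ≠ n →
      ∫ x in (-1 : ℝ)..1, (P m).eval x * (P n).eval x * ((1 - x) ^ α * (1 + x) ^ β) = 0)
    (n k : ℕ) (hk : k ≤ n) : ∀ q : Polynomial ℝ, q.degree < k →
      ∫ x in (-1 : ℝ)..1, (q * P n).eval x * ((1 - x) ^ α * (1 + x) ^ β) = 0 := by
  induction k with
  | zero =>
    intro q hq
    have : q = 0 := by
      rw [← Polynomial.degree_eq_bot]
      simpa using hq
    simp [this]
  | succ k ih =>
    intro q hq
    have hr : (q - C (q.coeff k) * P k).degree < (k : ℕ) := by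
      rw [Polynomial.degree_lt_iff_coeff_zero] at hq ⊢
      intro m hm
      rcases hm.eq_or_lt with rfl | hm
      · have : (P k).coeff k = 1 := by
          have := (hmonic k).coeff_natDegree
          rwa [hdeg k] at this
        simp [this]
      · have : (P k).coeff m = 0 :=
          Polynomial.coeff_eq_zero_of_natDegree_lt (by rw [hdeg k]; exact hm)
        simp [this, hq m hm]
    have h1 := ih (by omega) _ hr
    have h2 := horth k n (by omega)
    have h3 : ∀ x : ℝ, (q * P n).eval x * ((1 - x) ^ α * (1 + x) ^ β)
        = ((q - C (q.coeff k) * P k) * P n).eval x * ((1 - x) ^ α * (1 + x) ^ β)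
          + q.coeff k * ((P k * P n).eval x * ((1 - x) ^ α * (1 + x) ^ β)) := by
      intro x
      simp only [eval_mul, eval_sub, eval_C]
      ring
    simp_rw [h3]
    rw [intervalIntegral.integral_add (jac_int α β hα hβ _)
      ((jac_int α β hα hβ _).const_mul _), h1, intervalIntegral.integral_const_mul]
    simp only [eval_mul]
    rw [h2]
    simp

lemma jac_pos (α β : ℝ) (hα : 0 < α) (hβ : 0 < β) (p : Polynomial ℝ) (hp : p ≠ 0) :
    0 < ∫ x in (-1 : ℝ)..1, (p.eval x) ^ 2 * ((1 - x) ^ α * (1 + x) ^ β) := by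
  obtain ⟨c, hc, hc0⟩ : ∃ c ∈ Set.Ioo (-1 : ℝ) 1, p.eval c ≠ 0 := by
    by_contra! hcon
    exact hp (Polynomial.eq_zero_of_infinite_isRoot p
      ((Set.Ioo_infinite (by norm_num : (-1 : ℝ) < 1)).mono (fun x hx => hcon x hx)))
  refine intervalIntegral.integral_pos (by norm_num)
    ((p.continuous.pow 2).mul (jac_w_cont α β hα hβ)).continuousOn ?_ ⟨c, ⟨hc.1.le, hc.2.le⟩, ?_⟩
  · intro x hx
    have := Real.rpow_nonneg (show 0 ≤ 1 - x by linarith [hx.2]) α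
    have := Real.rpow_nonneg (show 0 ≤ 1 + x by linarith [hx.1]) β
    positivity
  · have := Real.rpow_pos_of_pos (show 0 < 1 - c by linarith [hc.2]) α
    have := Real.rpow_pos_of_pos (show 0 < 1 + c by linarith [hc.1]) β
    positivity

/-- Integration by parts. -/
lemma jac_parts (α β : ℝ) (hα : 0 < α) (hβ : 0 < β) (p : Polynomial ℝ) :
    ∫ x in (-1 : ℝ)..1, ((C 2 * (p * derivative p * (1 - X)) - C (α + β + 1) * p ^ 2).eval x
        * ((1 - x) ^ α * (1 + x) ^ β)
      + (C (2 * β) * p ^ 2).eval x * ((1 - x) ^ α * (1 + x) ^ (β - 1))) = 0 := by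
  have key := intervalIntegral.integral_eq_sub_of_hasDerivAt_of_le
    (f := fun x : ℝ => (p.eval x) ^ 2 * ((1 - x) ^ (α + 1) * (1 + x) ^ β))
    (f' := fun x : ℝ => ((C 2 * (p * derivative p * (1 - X)) - C (α + β + 1) * p ^ 2).eval x
        * ((1 - x) ^ α * (1 + x) ^ β)
      + (C (2 * β) * p ^ 2).eval x * ((1 - x) ^ α * (1 + x) ^ (β - 1))))
    (a := -1) (b := 1) (by norm_num)
    ((p.continuous.pow 2).mul (jac_w_cont (α + 1) β (by linarith) hβ)).continuousOn ?_
    ((jac_int α β hα hβ _).add (jac_int' α β hα hβ _))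
  · rw [key]
    have h1 : (α + 1) ≠ 0 := by linarith
    simp [Real.zero_rpow h1, Real.zero_rpow hβ.ne']
  · intro x hx
    have hx1 : 0 < 1 - x := by linarith [hx.2]
    have hx2 : 0 < 1 + x := by linarith [hx.1]
    have d1 : HasDerivAt (fun x : ℝ => (1 - x) ^ (α + 1)) (-1 * (α + 1) * (1 - x) ^ (α + 1 - 1)) x :=
      ((hasDerivAt_id x).const_sub 1).rpow_const (Or.inl hx1.ne')
    have d2 : HasDerivAt (fun x : ℝ => (1 + x) ^ β) (1 * β * (1 + x) ^ (β - 1)) x :=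
      ((hasDerivAt_id x).const_add 1).rpow_const (Or.inl hx2.ne')
    have d3 := ((p.hasDerivAt x).pow 2).mul (d1.mul d2)
    refine d3.congr_deriv ?_
    have e1 : (1 - x) ^ (α + 1) = (1 - x) ^ α * (1 - x) := by
      rw [Real.rpow_add hx1, Real.rpow_one]
    have e2 : (1 + x) ^ β = (1 + x) ^ (β - 1) * (1 + x) := by
      rw [← Real.rpow_add_one hx2.ne']; congr 1; ring
    simp only [Pi.mul_apply, Pi.pow_apply, e1, add_sub_cancel_right, eval_sub, eval_mul, eval_C, eval_pow,
      eval_one, eval_X]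
    rw [e2]
    push_cast
    ring

/-- for every `n ≥ 0`,
`Rₙ = (β/hₙ) ∫ Pₙ(y)² (1-y)^α (1+y)^(β-1) dy = (α + β + 2n + 1)/2`. -/
theorem jacobi_Rn_value
    (α β : ℝ) (hα : 0 < α) (hβ : 0 < β)
    (P : ℕ → Polynomial ℝ)
    (hmonic : ∀ n, (P n).Monic) (hdeg : ∀ n, (P n).natDegree = n)
    (horth : ∀ m n : ℕ, m ≠ n →
      ∫ x in (-1 : ℝ)..1, (P m).eval x * (P n).eval x * ((1 - x) ^ α * (1 + x) ^ β) = 0)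
    (h : ℕ → ℝ)
    (hh : ∀ n, h n = ∫ x in (-1 : ℝ)..1, ((P n).eval x) ^ 2 * ((1 - x) ^ α * (1 + x) ^ β)) :
    ∀ n : ℕ,
      (β / h n) * (∫ y in (-1 : ℝ)..1, ((P n).eval y) ^ 2 * ((1 - y) ^ α * (1 + y) ^ (β - 1)))
        = (α + β + 2 * (n : ℝ) + 1) / 2 := by
  intro n
  have hpos : 0 < h n := by
    rw [hh]; exact jac_pos α β hα hβ _ (hmonic n).ne_zero
  have hq : (derivative (P n) * (1 - X) + C (n : ℝ) * P n).degree < ((n : ℕ) : WithBot ℕ) := by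
    rw [Polynomial.degree_lt_iff_coeff_zero]
    intro m hm
    have c0 : ∀ j, n < j → (P n).coeff j = 0 := fun j hj =>
      Polynomial.coeff_eq_zero_of_natDegree_lt (by rw [hdeg n]; exact hj)
    rw [mul_sub, mul_one, coeff_add, coeff_sub, coeff_C_mul, coeff_derivative, c0 (m + 1) (by omega)]
    cases m with
    | zero =>
      have : n = 0 := by omega
      simp [this]
    | succ m =>
      rw [coeff_mul_X, coeff_derivative]
      rcases hm.eq_or_lt with rfl | hm
      · push_cast; ring
      · rw [c0 _ hm]; ring
  have horth' := jac_orth α β hα hβ P hmonic hdeg horth n n le_rfl _ hq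
  have hparts := jac_parts α β hα hβ (P n)
  have h3 : ∀ x : ℝ, ((C 2 * (P n * derivative (P n) * (1 - X)) - C (α + β + 1) * P n ^ 2).eval x
        * ((1 - x) ^ α * (1 + x) ^ β)
      + (C (2 * β) * P n ^ 2).eval x * ((1 - x) ^ α * (1 + x) ^ (β - 1)))
      = (2 * (((derivative (P n) * (1 - X) + C (n : ℝ) * P n) * P n).eval x
        * ((1 - x) ^ α * (1 + x) ^ β))
       - (α + β + 2 * n + 1) * ((P n ^ 2).eval x * ((1 - x) ^ α * (1 + x) ^ β)))
      + 2 * β * ((P n ^ 2).eval x * ((1 - x) ^ α * (1 + x) ^ (β - 1))) := by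
    intro x
    simp only [eval_add, eval_sub, eval_mul, eval_C, eval_pow, eval_one, eval_X]
    ring
  simp_rw [h3] at hparts
  rw [intervalIntegral.integral_add
      (((jac_int α β hα hβ _).const_mul _).sub ((jac_int α β hα hβ _).const_mul _))
      ((jac_int' α β hα hβ _).const_mul _),
    intervalIntegral.integral_sub ((jac_int α β hα hβ _).const_mul _)
      ((jac_int α β hα hβ _).const_mul _),
    intervalIntegral.integral_const_mul, intervalIntegral.integral_const_mul,
    intervalIntegral.integral_const_mul, horth'] at hparts
  simp only [eval_pow] at hparts
  rw [← hh n] at hparts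
  generalize (∫ x in (-1 : ℝ)..1, ((P n).eval x) ^ 2 * ((1 - x) ^ α * (1 + x) ^ (β - 1))) = I
    at hparts ⊢
  field_simp
  linarith
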